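/- arXiv:1106.2839 — 2 statements merged into one kernel-verified Lean document; each statement's English description precedes it below -/
import Mathlib

section
/- Let w ∈ S_N. If w has no N-occurrence of the pattern 4321, then |newrep(w)| ≤ [321;3412]_N(w). -/
/-!
Common framework.  Permutations of `{1, …, m}` are modelled as `Equiv.Perm (Fin m)`
with 0-based positions and values.  The simple reflection `sr m i` (for
`0 ≤ i ≤ m - 2`, corresponding to the paper's `s_{i+1}`) swaps the values `i` and
`i + 1`.  Cut statistics `Mstat w k` / `mstat w k` (the paper's `M_{k+1}`/`m_{k+1}`)
are respectively the maximum of the first `k + 1` entries and the minimum of the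
remaining entries of the one-line notation of `w`.
-/

/-- The simple reflection swapping `i` and `i + 1` (0-based) in the symmetric group
on `Fin m`; the identity if out of range. -/
def sr (m i : ℕ) : Equiv.Perm (Fin m) :=
  if h : i + 1 < m then Equiv.swap ⟨i, Nat.lt_of_succ_lt h⟩ ⟨i + 1, h⟩ else 1

/-- `l` is a word in the simple reflections whose product is `w`. -/
def IsWord (m : ℕ) (l : List ℕ) (w : Equiv.Perm (Fin m)) : Prop :=
  (∀ i ∈ l, i + 1 < m) ∧ (l.map (sr m)).prod = w

/-- The Coxeter length `ℓ(w)`: the minimal length of a word expressing `w`. -/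
noncomputable def len {m : ℕ} (w : Equiv.Perm (Fin m)) : ℕ :=
  sInf {c | ∃ l : List ℕ, IsWord m l w ∧ l.length = c}

/-- `l` is a reduced decomposition of `w`. -/
def IsReducedWord {m : ℕ} (w : Equiv.Perm (Fin m)) (l : List ℕ) : Prop :=
  IsWord m l w ∧ l.length = len w

/-- The support of `w`: the letters appearing in some reduced decomposition. -/
noncomputable def supp {m : ℕ} (w : Equiv.Perm (Fin m)) : Set ℕ :=
  {i | ∃ l : List ℕ, IsReducedWord w l ∧ i ∈ l}

/-- `rep w = ℓ(w) - |supp w|`, the number of repeated letters. -/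
noncomputable def rep {m : ℕ} (w : Equiv.Perm (Fin m)) : ℕ :=
  len w - (supp w).ncard

/-- The value of `w` at the (0-based) position `i`, as a natural number. -/
def valAt {m : ℕ} (w : Equiv.Perm (Fin m)) (i : ℕ) : ℕ :=
  if h : i < m then (w ⟨i, h⟩ : ℕ) else 0

/-- The (0-based) position at which the value `v` occurs in `w`. -/
def posOf {m : ℕ} (w : Equiv.Perm (Fin m)) (v : ℕ) : ℕ :=
  if h : v < m then (w⁻¹ ⟨v, h⟩ : ℕ) else 0

/-- `Mstat w k`: the maximum of the first `k + 1` entries of `w`. -/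
noncomputable def Mstat {m : ℕ} (w : Equiv.Perm (Fin m)) (k : ℕ) : ℕ :=
  sSup {v | ∃ i : Fin m, (i : ℕ) ≤ k ∧ (w i : ℕ) = v}

/-- `mstat w k`: the minimum of the entries of `w` in positions `> k`. -/
noncomputable def mstat {m : ℕ} (w : Equiv.Perm (Fin m)) (k : ℕ) : ℕ :=
  sInf {v | ∃ i : Fin m, k < (i : ℕ) ∧ (w i : ℕ) = v}

/-- `wbar` is obtained from `w` by deleting the largest letter from the one-line
notation of `w` and sliding all subsequent letters one space to the left. -/
def IsDeletion {n : ℕ} (w : Equiv.Perm (Fin (n + 1))) (wbar : Equiv.Perm (Fin n)) : Prop :=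
  ∀ i : Fin n, (wbar i : ℕ) =
    if (i : ℕ) < posOf w n then valAt w (i : ℕ) else valAt w ((i : ℕ) + 1)

/-- `newrep w wbar`: the letters `k` with `s_k ∈ supp(wbar)` and `w⁻¹(top) ≤ k`. -/
noncomputable def newrep {n : ℕ} (w : Equiv.Perm (Fin (n + 1))) (wbar : Equiv.Perm (Fin n)) :
    Set ℕ :=
  {k | k ∈ supp wbar ∧ posOf w n ≤ k}

/-- An occurrence of the pattern `p` in `w`, recorded by its set `S` of values:
there are positions `f 0 < f 1 < ⋯` whose values are in the same relative order
as `p`, and `S` is the corresponding set of values. -/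
def IsOccSet {m c : ℕ} (p : Fin c → ℕ) (w : Equiv.Perm (Fin m)) (S : Finset ℕ) : Prop :=
  ∃ f : Fin c → Fin m, StrictMono f ∧ (∀ a b : Fin c, p a < p b ↔ w (f a) < w (f b)) ∧
    S = Finset.image (fun a => (w (f a) : ℕ)) Finset.univ

/-- An `N`-occurrence (here `N = n`, the largest 0-based value): an occurrence
whose largest letter is the largest value of `w`. -/
def IsTopOccSet {n c : ℕ} (p : Fin c → ℕ) (w : Equiv.Perm (Fin (n + 1))) (S : Finset ℕ) : Prop :=
  IsOccSet p w S ∧ n ∈ S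

/-- The number of occurrences of the pattern `p` in `w`. -/
noncomputable def occCount {m c : ℕ} (p : Fin c → ℕ) (w : Equiv.Perm (Fin m)) : ℕ :=
  Set.ncard {S : Finset ℕ | IsOccSet p w S}

/-- The number of `N`-occurrences of the pattern `p` in `w`. -/
noncomputable def topOccCount {n c : ℕ} (p : Fin c → ℕ) (w : Equiv.Perm (Fin (n + 1))) : ℕ :=
  Set.ncard {S : Finset ℕ | IsTopOccSet p w S}

def p321 : Fin 3 → ℕ := ![3, 2, 1]
def p3412 : Fin 4 → ℕ := ![3, 4, 1, 2]
def p4321 : Fin 4 → ℕ := ![4, 3, 2, 1]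
def p34512 : Fin 5 → ℕ := ![3, 4, 5, 1, 2]
def p45123 : Fin 5 → ℕ := ![4, 5, 1, 2, 3]
def p35412 : Fin 5 → ℕ := ![3, 5, 4, 1, 2]
def p43512 : Fin 5 → ℕ := ![4, 3, 5, 1, 2]
def p45132 : Fin 5 → ℕ := ![4, 5, 1, 3, 2]
def p45213 : Fin 5 → ℕ := ![4, 5, 2, 1, 3]
def p53412 : Fin 5 → ℕ := ![5, 3, 4, 1, 2]
def p45312 : Fin 5 → ℕ := ![4, 5, 3, 1, 2]
def p45231 : Fin 5 → ℕ := ![4, 5, 2, 3, 1]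

/-- The pattern `𝔭_k(w)` of Definition 4.4, recorded as its set of values:
(I) if `w⁻¹(top)` is left of `w⁻¹(M_k)`, the 321-occurrence `{top, M_k, m_k}`;
(II) else if `wbar(k) > m_k`, the 321-occurrence `{top, wbar(k), m_k}`;
(III) otherwise the 3412-occurrence `{M_k, top, wbar(k), m_k}`. -/
noncomputable def pocc {n : ℕ} (w : Equiv.Perm (Fin (n + 1))) (wbar : Equiv.Perm (Fin n))
    (k : ℕ) : Finset ℕ :=
  if posOf w n < posOf w (Mstat wbar k) then {n, Mstat wbar k, mstat wbar k}
  else if mstat wbar k < valAt wbar k then {n, valAt wbar k, mstat wbar k}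
  else {Mstat wbar k, n, valAt wbar k, mstat wbar k}

/-- The inversions of `w`, recorded as pairs of positions. -/
def inversions {m : ℕ} (w : Equiv.Perm (Fin m)) : Finset (Fin m × Fin m) :=
  Finset.univ.filter fun x => x.1 < x.2 ∧ w x.2 < w x.1

lemma mem_inversions {m : ℕ} {w : Equiv.Perm (Fin m)} {x y : Fin m} :
    (x, y) ∈ inversions w ↔ x < y ∧ w y < w x := by
  simp [inversions]

lemma sr_val {m i : ℕ} (h : i + 1 < m) (u : Fin m) :
    (sr m i u : ℕ) = if (u : ℕ) = i then i + 1 else if (u : ℕ) = i + 1 then i else u := by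
  simp only [sr, h, dite_true, Equiv.swap_apply_def, Fin.ext_iff]
  split_ifs <;> rfl

lemma sr_mul_self (m i : ℕ) : sr m i * sr m i = 1 := by
  unfold sr
  split_ifs <;> simp

lemma sr_mul_sr_mul {m : ℕ} (i : ℕ) (w : Equiv.Perm (Fin m)) : sr m i * (sr m i * w) = w := by
  rw [← mul_assoc, sr_mul_self, one_mul]

lemma card_inversions_sr_mul {m i : ℕ} (w : Equiv.Perm (Fin m)) {a b : Fin m}
    (ha : (w a : ℕ) = i) (hb : (w b : ℕ) = i + 1) (hab : a < b) :
    (inversions (sr m i * w)).card = (inversions w).card + 1 := by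
  have h : i + 1 < m := hb ▸ (w b).isLt
  have hinj : ∀ x y : Fin m, (w x : ℕ) = w y → x = y := fun x y hxy =>
    w.injective (Fin.ext hxy)
  have hnot : (a, b) ∉ inversions w := by
    rw [mem_inversions, Fin.lt_def (a := w b), ha, hb]
    omega
  rw [← Finset.card_insert_of_notMem hnot]
  congr 1
  ext ⟨x, y⟩
  rw [Finset.mem_insert, mem_inversions, mem_inversions, Prod.mk.injEq, Fin.lt_def (a := w y),
    Fin.lt_def (a := (sr m i * w) y), Equiv.Perm.mul_apply, Equiv.Perm.mul_apply,
    sr_val h, sr_val h]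
  have := hinj x a
  have := hinj x b
  have := hinj y a
  have := hinj y b
  have := hinj x y
  grind

lemma card_inversions_sr_mul_of_gt {m i : ℕ} (w : Equiv.Perm (Fin m)) {a b : Fin m}
    (ha : (w a : ℕ) = i) (hb : (w b : ℕ) = i + 1) (hba : b < a) :
    (inversions w).card = (inversions (sr m i * w)).card + 1 := by
  have h : i + 1 < m := hb ▸ (w b).isLt
  conv_lhs => rw [← sr_mul_sr_mul i w]
  refine card_inversions_sr_mul _ (a := b) (b := a) ?_ ?_ hba
  · simp [sr_val h, hb]
  · simp [sr_val h, ha]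

lemma exists_preimages_of_letter {m i : ℕ} (w : Equiv.Perm (Fin m)) (h : i + 1 < m) :
    ∃ a b : Fin m, (w a : ℕ) = i ∧ (w b : ℕ) = i + 1 ∧ a ≠ b := by
  refine ⟨w⁻¹ ⟨i, by omega⟩, w⁻¹ ⟨i + 1, h⟩, by simp, by simp, ?_⟩
  simp

lemma card_inversions_sr_mul_le {m i : ℕ} (w : Equiv.Perm (Fin m)) (h : i + 1 < m) :
    (inversions (sr m i * w)).card ≤ (inversions w).card + 1 := by
  obtain ⟨a, b, ha, hb, hab⟩ := exists_preimages_of_letter w h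
  rcases lt_or_gt_of_ne hab with hab | hab
  · exact (card_inversions_sr_mul w ha hb hab).le
  · have := card_inversions_sr_mul_of_gt w ha hb hab
    omega

lemma card_inversions_le_length {m : ℕ} (l : List ℕ) (hl : ∀ i ∈ l, i + 1 < m) :
    (inversions (l.map (sr m)).prod).card ≤ l.length := by
  induction l with
  | nil =>
    simp only [List.map_nil, List.prod_nil, List.length_nil, Nat.le_zero, Finset.card_eq_zero]
    ext ⟨x, y⟩
    simp only [mem_inversions, Equiv.Perm.one_apply, Finset.notMem_empty, iff_false]
    omega
  | cons i l ih =>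
    simp only [List.map_cons, List.prod_cons, List.length_cons]
    have h := card_inversions_sr_mul_le (l.map (sr m)).prod (hl i (by simp))
    have := ih fun j hj => hl j (by simp [hj])
    omega

/-- A permutation without an adjacent pair of values in the wrong order is the identity. -/
lemma eq_one_of_no_descent {m : ℕ} (w : Equiv.Perm (Fin m))
    (h : ∀ a b : Fin m, (w b : ℕ) = w a + 1 → a < b) : w = 1 := by
  have hmono : StrictMono (w⁻¹ : Equiv.Perm (Fin m)) := by
    cases m with
    | zero => exact fun x => x.elim0
    | succ m =>
      refine Fin.strictMono_iff_lt_succ.2 fun i => h _ _ ?_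
      simp
  have hid := Subsingleton.elim (hmono.orderIsoOfSurjective _ (w⁻¹).surjective)
    (OrderIso.refl (Fin m))
  rw [← inv_eq_one]
  ext x
  exact congrArg Fin.val (DFunLike.congr_fun hid x)

lemma exists_word_of_card_inversions {m : ℕ} (w : Equiv.Perm (Fin m)) :
    ∃ l, IsWord m l w ∧ l.length = (inversions w).card := by
  induction hc : (inversions w).card using Nat.strong_induction_on generalizing w with
  | _ c ih =>
    by_cases h : ∀ a b : Fin m, (w b : ℕ) = w a + 1 → a < b
    · obtain rfl := eq_one_of_no_descent w h
      refine ⟨[], ⟨by simp, by simp⟩, ?_⟩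
      have := card_inversions_le_length (m := m) [] (by simp)
      simp only [List.map_nil, List.prod_nil, List.length_nil] at this ⊢
      omega
    · push Not at h
      obtain ⟨a, b, hb, hba⟩ := h
      have hne : b ≠ a := by
        rintro rfl
        omega
      have hcard := card_inversions_sr_mul_of_gt w rfl hb (lt_of_le_of_ne hba hne)
      obtain ⟨l, ⟨hl, hprod⟩, hlen⟩ := ih _ (by omega) (sr m (w a) * w) rfl
      refine ⟨(w a : ℕ) :: l, ⟨?_, ?_⟩, ?_⟩
      · intro j hj
        rcases List.mem_cons.1 hj with rfl | hj
        · exact hb ▸ (w b).isLt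
        · exact hl j hj
      · rw [List.map_cons, List.prod_cons, hprod, sr_mul_sr_mul]
      · rw [List.length_cons, hlen]
        omega

lemma len_le_card_inversions {m : ℕ} (w : Equiv.Perm (Fin m)) :
    len w ≤ (inversions w).card :=
  Nat.sInf_le (exists_word_of_card_inversions w)

/-- A word as short as the inversion number of its product `w` avoids the letter `k` when `w`
preserves the set `{0, …, k}`. -/
lemma notMem_of_preserves {m k : ℕ} (l : List ℕ) (hl : ∀ i ∈ l, i + 1 < m)
    (hlen : l.length ≤ (inversions (l.map (sr m)).prod).card)
    (hk : ∀ x : Fin m, ((l.map (sr m)).prod x : ℕ) ≤ k ↔ (x : ℕ) ≤ k) : k ∉ l := by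
  induction l with
  | nil => simp
  | cons i l ih =>
    have hi := hl i (by simp)
    have hl' : ∀ j ∈ l, j + 1 < m := fun j hj => hl j (by simp [hj])
    simp only [List.map_cons, List.prod_cons, List.length_cons] at hlen hk
    set v := (l.map (sr m)).prod with hv
    have hle := card_inversions_le_length l hl'
    rw [← hv] at hle
    have hle' := card_inversions_sr_mul_le v hi
    obtain ⟨a, b, ha, hb, hne⟩ := exists_preimages_of_letter v hi
    have hab : a < b := by
      rcases lt_or_gt_of_ne hne with hab | hab
      · exact hab
      · have := card_inversions_sr_mul_of_gt v ha hb hab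
        omega
    have hka := hk a
    have hkb := hk b
    rw [Equiv.Perm.mul_apply, sr_val hi] at hka hkb
    have hik : i ≠ k := by
      rintro rfl
      simp only [ha, hb] at hka hkb
      grind
    rw [List.mem_cons, not_or]
    refine ⟨hik.symm, ih hl' (by omega) fun x => ?_⟩
    rw [← hk x, Equiv.Perm.mul_apply, sr_val hi]
    split_ifs <;> omega

lemma lt_of_mem_supp {m k : ℕ} {w : Equiv.Perm (Fin m)} (h : k ∈ supp w) : k + 1 < m := by
  obtain ⟨l, ⟨⟨hl, -⟩, -⟩, hkl⟩ := h
  exact hl k hkl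

lemma exists_le_lt_of_mem_supp {m k : ℕ} {w : Equiv.Perm (Fin m)} (h : k ∈ supp w) :
    ∃ x : Fin m, (x : ℕ) ≤ k ∧ k < w x := by
  by_contra! hcon
  obtain ⟨l, ⟨⟨hl, rfl⟩, hlen⟩, hkl⟩ := h
  set w := (l.map (sr m)).prod
  refine notMem_of_preserves l hl (hlen.trans_le (len_le_card_inversions w)) (fun x => ?_) hkl
  have hmaps : Set.MapsTo w {x : Fin m | (x : ℕ) ≤ k} {x : Fin m | (x : ℕ) ≤ k} := hcon
  refine ⟨fun hx => ?_, hcon x⟩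
  simpa using Equiv.Perm.perm_symm_mapsTo_of_mapsTo w hmaps (x := w x) hx

lemma exists_lt_le_of_mem_supp {m k : ℕ} {w : Equiv.Perm (Fin m)} (h : k ∈ supp w) :
    ∃ x : Fin m, k < (x : ℕ) ∧ (w x : ℕ) ≤ k := by
  by_contra! hcon
  obtain ⟨x, hx, hkx⟩ := exists_le_lt_of_mem_supp h
  have hmaps : Set.MapsTo w {x : Fin m | k < (x : ℕ)} {x : Fin m | k < (x : ℕ)} := hcon
  have hkx' : k < (x : ℕ) := by
    simpa using Equiv.Perm.perm_symm_mapsTo_of_mapsTo w hmaps (x := w x) hkx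
  omega

/-- `S` is the set of values of the pattern attached to the cut after position `k` of `v`, where
a new largest letter `n` is inserted at position `p`: `a` is the position of the largest value up
to `k`, and `b` is the position of the smallest value after `k`. -/
def IsCutOcc {n : ℕ} (v : Equiv.Perm (Fin n)) (p k : ℕ) (S : Finset ℕ) : Prop :=
  ∃ a b c : Fin n, (c : ℕ) = k ∧ (a : ℕ) ≤ k ∧ k < b ∧ (v b : ℕ) < v a ∧
    (∀ i : Fin n, (i : ℕ) ≤ k → (v i : ℕ) ≤ v a) ∧
    (∀ j : Fin n, k < (j : ℕ) → (v b : ℕ) ≤ v j) ∧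
    (p ≤ a ∧ S = {n, (v a : ℕ), (v b : ℕ)} ∨
      (a : ℕ) < p ∧ (v b : ℕ) < v c ∧ S = {n, (v c : ℕ), (v b : ℕ)} ∨
      (a : ℕ) < p ∧ (v c : ℕ) < v b ∧ S = {(v a : ℕ), n, (v c : ℕ), (v b : ℕ)})

lemma exists_isCutOcc {n k : ℕ} {v : Equiv.Perm (Fin n)} (p : ℕ) (hk : k ∈ supp v) :
    ∃ S, IsCutOcc v p k S := by
  have hkn := lt_of_mem_supp hk
  obtain ⟨x, hxk, hx⟩ := exists_le_lt_of_mem_supp hk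
  obtain ⟨y, hky, hy⟩ := exists_lt_le_of_mem_supp hk
  obtain ⟨a, ha, hamax⟩ := Finset.exists_max_image
    (Finset.univ.filter fun i : Fin n => (i : ℕ) ≤ k) (fun i => (v i : ℕ)) ⟨x, by simpa using hxk⟩
  obtain ⟨b, hb, hbmin⟩ := Finset.exists_min_image
    (Finset.univ.filter fun i : Fin n => k < (i : ℕ)) (fun i => (v i : ℕ)) ⟨y, by simpa using hky⟩
  simp only [Finset.mem_filter, Finset.mem_univ, true_and] at ha hb hamax hbmin
  have hxa := hamax x hxk
  have hyb := hbmin y hky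
  have hcb : (v ⟨k, by omega⟩ : ℕ) ≠ v b := fun h => by
    have := congrArg Fin.val (v.injective (Fin.ext h))
    simp only at this
    omega
  rcases le_or_gt p a with hp | hp
  · exact ⟨_, a, b, ⟨k, by omega⟩, rfl, ha, hb, by omega, hamax, hbmin, Or.inl ⟨hp, rfl⟩⟩
  rcases lt_or_gt_of_ne hcb with h | h
  · exact ⟨_, a, b, ⟨k, by omega⟩, rfl, ha, hb, by omega, hamax, hbmin,
      Or.inr (Or.inr ⟨hp, h, rfl⟩)⟩
  · exact ⟨_, a, b, ⟨k, by omega⟩, rfl, ha, hb, by omega, hamax, hbmin,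
      Or.inr (Or.inl ⟨hp, h, rfl⟩)⟩

lemma triple_eq {n x y x' y' : ℕ} (hy : y < x) (hx' : x' < n) (hy' : y' < x')
    (h : ({n, x, y} : Finset ℕ) = {n, x', y'}) : x = x' ∧ y = y' := by
  simp only [Finset.ext_iff, Finset.mem_insert, Finset.mem_singleton] at h
  have := h x
  have := h y
  have := h x'
  have := h y'
  omega

lemma triple_ne_quadruple {n x y z c b : ℕ} (hcb : c < b) (hbz : b < z) (hz : z < n) :
    ({n, x, y} : Finset ℕ) ≠ {z, n, c, b} := by
  intro h
  simp only [Finset.ext_iff, Finset.mem_insert, Finset.mem_singleton] at h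
  have := h z
  have := h c
  have := h b
  omega

lemma quadruple_min_eq {n z c b z' c' b' : ℕ} (hcb : c < b) (hbz : b < z) (hz : z < n)
    (hcb' : c' < b') (hbz' : b' < z') (hz' : z' < n)
    (h : ({z, n, c, b} : Finset ℕ) = {z', n, c', b'}) : c = c' := by
  simp only [Finset.ext_iff, Finset.mem_insert, Finset.mem_singleton] at h
  have := h c
  have := h c'
  omega

lemma IsCutOcc.not_lt {n p k l : ℕ} {v : Equiv.Perm (Fin n)} {S : Finset ℕ}
    (hk : IsCutOcc v p k S) (hl : IsCutOcc v p l S)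
    (h321 : ∀ x y z : Fin n, p ≤ x → x < y → y < z → v y < v x → ¬ v z < v y) : ¬ k < l := by
  intro hkl
  obtain ⟨a, b, c, hc, ha, hb, hba, hamax, hbmin, hS⟩ := hk
  obtain ⟨a', b', c', hc', ha', hb', hba', hamax', hbmin', hS'⟩ := hl
  have hinj : ∀ x y : Fin n, (v x : ℕ) = v y → (x : ℕ) = y := fun x y h =>
    congrArg Fin.val (v.injective (Fin.ext h))
  have hlt : ∀ x : Fin n, (v x : ℕ) < n := fun x => (v x).isLt
  have hca : c' ≠ a := by
    rintro rfl
    omega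
  have hac := hamax c hc.le
  have hac_eq := hinj c a
  rcases hS with ⟨hp, rfl⟩ | ⟨hp, hbc, rfl⟩ | ⟨hp, hcb, rfl⟩ <;>
    rcases hS' with ⟨hp', hS'⟩ | ⟨hp', hbc', hS'⟩ | ⟨hp', hcb', hS'⟩
  · obtain ⟨h₁, h₂⟩ := triple_eq hba (hlt a') hba' hS'
    have := hinj _ _ h₁
    have := hinj _ _ h₂
    have := hamax' c' hc'.le
    have := hbmin c' (by omega)
    have := hinj c' a
    have := hinj c' b
    refine h321 a c' b hp ?_ ?_ ?_ ?_ <;> rw [Fin.lt_def] <;> omega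
  · have := hinj _ _ (triple_eq hba (hlt c') hbc' hS').1
    omega
  · exact triple_ne_quadruple hcb' hba' (hlt a') hS'
  · have := (triple_eq hbc (hlt a') hba' hS').1
    have := hamax' a (by omega)
    have := hinj a a'
    omega
  · have := hinj _ _ (triple_eq hbc (hlt c') hbc' hS').1
    omega
  · exact triple_ne_quadruple hcb' hba' (hlt a') hS'
  · exact triple_ne_quadruple hcb hba (hlt a) hS'.symm
  · exact triple_ne_quadruple hcb hba (hlt a) hS'.symm
  · have := hinj _ _ (quadruple_min_eq hcb hba (hlt a) hcb' hba' (hlt a') hS')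
    omega

lemma isTopOccSet_p321 {n : ℕ} {w : Equiv.Perm (Fin (n + 1))} {p x y : Fin (n + 1)}
    (hp : (w p : ℕ) = n) (hpx : p < x) (hxy : x < y) (hx : w x < w p) (hy : w y < w x) :
    IsTopOccSet p321 w {n, (w x : ℕ), (w y : ℕ)} := by
  refine ⟨⟨![p, x, y], ?_, ?_, ?_⟩, by simp⟩
  · simp [Fin.strictMono_iff_lt_succ, Fin.forall_fin_succ, hpx, hxy]
  · simp [Fin.forall_fin_succ, p321, hx, hy, hy.trans hx, hx.le, hy.le, (hy.trans hx).le]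
  · simp [Fin.univ_succ, hp]

lemma isTopOccSet_p3412 {n : ℕ} {w : Equiv.Perm (Fin (n + 1))} {x p y z : Fin (n + 1)}
    (hp : (w p : ℕ) = n) (hxp : x < p) (hpy : p < y) (hyz : y < z) (hx : w x < w p)
    (hy : w y < w z) (hz : w z < w x) :
    IsTopOccSet p3412 w {(w x : ℕ), n, (w y : ℕ), (w z : ℕ)} := by
  refine ⟨⟨![x, p, y, z], ?_, ?_, ?_⟩, by simp⟩
  · simp [Fin.strictMono_iff_lt_succ, Fin.forall_fin_succ, hxp, hpy, hyz]
  · have h₁ := hy.trans hz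
    have h₂ := hz.trans hx
    have h₃ := h₁.trans hx
    simp [Fin.forall_fin_succ, p3412, hx, hy, hz, h₁, h₂, h₃, hx.le, hy.le, hz.le, h₁.le, h₂.le,
      h₃.le]
  · simp [Fin.univ_succ, hp]

lemma isTopOccSet_p4321 {n : ℕ} {w : Equiv.Perm (Fin (n + 1))} {p x y z : Fin (n + 1)}
    (hp : (w p : ℕ) = n) (hpx : p < x) (hxy : x < y) (hyz : y < z) (hx : w x < w p)
    (hy : w y < w x) (hz : w z < w y) :
    IsTopOccSet p4321 w {n, (w x : ℕ), (w y : ℕ), (w z : ℕ)} := by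
  refine ⟨⟨![p, x, y, z], ?_, ?_, ?_⟩, by simp⟩
  · simp [Fin.strictMono_iff_lt_succ, Fin.forall_fin_succ, hpx, hxy, hyz]
  · have h₁ := hy.trans hx
    have h₂ := hz.trans hy
    have h₃ := h₂.trans hx
    simp [Fin.forall_fin_succ, p4321, hx, hy, hz, h₁, h₂, h₃, hx.le, hy.le, hz.le, h₁.le, h₂.le,
      h₃.le]
  · simp [Fin.univ_succ, hp]

lemma exists_posOf_last {n : ℕ} (w : Equiv.Perm (Fin (n + 1))) :
    ∃ p : Fin (n + 1), (w p : ℕ) = n ∧ posOf w n = p :=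
  ⟨w⁻¹ (Fin.last n), by simp, by simp [posOf, Fin.last]⟩

lemma IsDeletion.exists_apply_eq {n : ℕ} {w : Equiv.Perm (Fin (n + 1))}
    {wbar : Equiv.Perm (Fin n)} (hdel : IsDeletion w wbar) (i : Fin n) :
    ∃ j : Fin (n + 1), (w j : ℕ) = wbar i ∧
      ((i : ℕ) < posOf w n ∧ (j : ℕ) = i ∨ posOf w n ≤ i ∧ (j : ℕ) = i + 1) := by
  have hi := hdel i
  split_ifs at hi with h
  · exact ⟨i.castSucc, by rw [hi, valAt, dif_pos]; rfl, Or.inl ⟨h, rfl⟩⟩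
  · exact ⟨i.succ, by rw [hi, valAt, dif_pos]; rfl, Or.inr ⟨not_lt.1 h, by simp⟩⟩

lemma IsCutOcc.isTopOccSet {n k : ℕ} {w : Equiv.Perm (Fin (n + 1))} {wbar : Equiv.Perm (Fin n)}
    {S : Finset ℕ} (hdel : IsDeletion w wbar) (hk : posOf w n ≤ k)
    (hS : IsCutOcc wbar (posOf w n) k S) : IsTopOccSet p321 w S ∨ IsTopOccSet p3412 w S := by
  obtain ⟨a, b, c, hc, ha, hb, hba, -, -, hS⟩ := hS
  obtain ⟨p, hp, hpos⟩ := exists_posOf_last w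
  obtain ⟨x, hx, hxa⟩ := hdel.exists_apply_eq a
  obtain ⟨y, hy, hyc⟩ := hdel.exists_apply_eq c
  obtain ⟨z, hz, hzb⟩ := hdel.exists_apply_eq b
  have hltn := (wbar a).isLt
  have hltn' := (wbar c).isLt
  rcases hS with ⟨hpa, rfl⟩ | ⟨hpa, hbc, rfl⟩ | ⟨hpa, hcb, rfl⟩
  · left
    rw [← hx, ← hz]
    apply isTopOccSet_p321 hp <;> rw [Fin.lt_def] <;> omega
  · left
    rw [← hy, ← hz]
    apply isTopOccSet_p321 hp <;> rw [Fin.lt_def] <;> omega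
  · right
    rw [← hx, ← hy, ← hz]
    apply isTopOccSet_p3412 hp <;> rw [Fin.lt_def] <;> omega

lemma IsDeletion.not_lt_of_no_top_4321 {n : ℕ} {w : Equiv.Perm (Fin (n + 1))}
    {wbar : Equiv.Perm (Fin n)} (hdel : IsDeletion w wbar)
    (h4321 : ¬ ∃ S : Finset ℕ, IsTopOccSet p4321 w S) (a b c : Fin n) (ha : posOf w n ≤ a)
    (hab : a < b) (hbc : b < c) (hba : wbar b < wbar a) : ¬ wbar c < wbar b := by
  intro hcb
  obtain ⟨p, hp, hpos⟩ := exists_posOf_last w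
  obtain ⟨x, hx, hxa⟩ := hdel.exists_apply_eq a
  obtain ⟨y, hy, hyb⟩ := hdel.exists_apply_eq b
  obtain ⟨z, hz, hzc⟩ := hdel.exists_apply_eq c
  have hltn := (wbar a).isLt
  rw [Fin.lt_def] at hab hbc hba hcb
  apply h4321
  refine ⟨_, isTopOccSet_p4321 (x := x) (y := y) (z := z) hp ?_ ?_ ?_ ?_ ?_ ?_⟩ <;>
    rw [Fin.lt_def] <;> omega

lemma finite_setOf_isTopOccSet {n c : ℕ} (p : Fin c → ℕ) (w : Equiv.Perm (Fin (n + 1))) :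
    {S | IsTopOccSet p w S}.Finite := by
  refine (Finset.finite_toSet (Finset.range (n + 1)).powerset).subset ?_
  rintro S ⟨⟨f, -, -, rfl⟩, -⟩
  simp only [Finset.coe_powerset, Set.mem_preimage, Set.mem_powerset_iff, Finset.coe_subset]
  intro v hv
  obtain ⟨i, -, rfl⟩ := Finset.mem_image.1 hv
  exact Finset.mem_range.2 (w (f i)).isLt

/-- if `w` has no `N`-occurrence of 4321, then
`|newrep(w)| ≤ [321;3412]_N(w)`. -/
theorem newrep_card_le_of_no_top_4321 {n : ℕ} (w : Equiv.Perm (Fin (n + 1)))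
    (wbar : Equiv.Perm (Fin n)) (hdel : IsDeletion w wbar)
    (h4321 : ¬ ∃ S : Finset ℕ, IsTopOccSet p4321 w S) :
    (newrep w wbar).ncard ≤ topOccCount p321 w + topOccCount p3412 w := by
  have h321 := hdel.not_lt_of_no_top_4321 h4321
  choose! F hF using fun k (hk : k ∈ newrep w wbar) => exists_isCutOcc (posOf w n) hk.1
  refine (Set.ncard_le_ncard_of_injOn (t := {S | IsTopOccSet p321 w S} ∪
    {S | IsTopOccSet p3412 w S}) F (fun k hk => (hF k hk).isTopOccSet hdel hk.2) ?_
    ((finite_setOf_isTopOccSet _ w).union (finite_setOf_isTopOccSet _ w))).trans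
    (Set.ncard_union_le _ _)
  intro k hk l hl hkl
  have hFk := hF k hk
  rw [hkl] at hFk
  exact le_antisymm (not_lt.1 ((hF l hl).not_lt hFk h321)) (not_lt.1 (hFk.not_lt (hF l hl) h321))
end

section
/- Let w ∈ S_N be 4321-avoiding. If some N-occurrence {N > a > b} of the pattern 321 in w is such that there exists no k ∈ newrep(w) with (a,b) ∈ {(M_k, m_k), (w̄(k), m_k)}, then w has an N-occurrence of at least one of the patterns 45312 and 53412. -/
theorem exists_isWord {m : ℕ} (w : Equiv.Perm (Fin m)) : ∃ l : List ℕ, IsWord m l w := by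
  rcases m with _ | m
  · exact ⟨[], by simp, Subsingleton.elim _ _⟩
  · have hw : w ∈ Submonoid.closure
        (Set.range fun i : Fin m => Equiv.swap i.castSucc i.succ) := by
      rw [Equiv.Perm.mclosure_swap_castSucc_succ]
      exact Submonoid.mem_top w
    induction hw using Submonoid.closure_induction with
    | mem x hx =>
      obtain ⟨i, rfl⟩ := hx
      refine ⟨[(i : ℕ)], by simp, ?_⟩
      simp only [List.map_cons, List.map_nil, List.prod_cons, List.prod_nil, mul_one, sr]
      rw [dif_pos (by omega)]
      rfl
    | one => exact ⟨[], by simp, rfl⟩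
    | mul x y _ _ hx hy =>
      obtain ⟨l₁, h₁, e₁⟩ := hx
      obtain ⟨l₂, h₂, e₂⟩ := hy
      refine ⟨l₁ ++ l₂, ?_, by simp [e₁, e₂]⟩
      intro i hi
      rcases List.mem_append.1 hi with h | h
      exacts [h₁ i h, h₂ i h]

theorem exists_isReducedWord {m : ℕ} (w : Equiv.Perm (Fin m)) :
    ∃ l : List ℕ, IsReducedWord w l := by
  obtain ⟨l, hl⟩ := exists_isWord w
  exact Nat.sInf_mem (s := {c | ∃ l : List ℕ, IsWord m l w ∧ l.length = c}) ⟨l.length, l, hl, rfl⟩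

theorem sr_apply_le_iff {m i k : ℕ} (hik : i ≠ k) (x : Fin m) :
    (sr m i x : ℕ) ≤ k ↔ (x : ℕ) ≤ k := by
  unfold sr
  split_ifs with h
  · rw [Equiv.swap_apply_def]
    split_ifs with h₁ h₂
    · subst h₁
      simp only
      omega
    · subst h₂
      simp only
      omega
    · rfl
  · rfl

theorem prod_sr_apply_le_iff {m k : ℕ} (l : List ℕ) (hl : k ∉ l) (x : Fin m) :
    ((l.map (sr m)).prod x : ℕ) ≤ k ↔ (x : ℕ) ≤ k := by
  induction l with
  | nil => simp
  | cons i l ih =>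
    rw [List.mem_cons, not_or] at hl
    rw [List.map_cons, List.prod_cons, Equiv.Perm.mul_apply, sr_apply_le_iff (Ne.symm hl.1),
      ih hl.2]

/-- An inversion straddling the cut after position `k` puts `k` in the support. -/
theorem mem_supp_of_inversion {m k : ℕ} (w : Equiv.Perm (Fin m)) (x y : Fin m)
    (hx : (x : ℕ) ≤ k) (hy : k < (y : ℕ)) (hxy : w y < w x) : k ∈ supp w := by
  obtain ⟨l, hl⟩ := exists_isReducedWord w
  refine ⟨l, hl, ?_⟩
  by_contra hk
  have h := prod_sr_apply_le_iff (m := m) l hk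
  rw [hl.1.2] at h
  have h₁ := h x
  have h₂ := h y
  have h₃ : (w y : ℕ) < w x := hxy
  omega

theorem mstat_eq {m k : ℕ} (w : Equiv.Perm (Fin m)) (x : Fin m) (hx : k < (x : ℕ))
    (h : ∀ y : Fin m, k < (y : ℕ) → w x ≤ w y) : mstat w k = w x := by
  refine IsLeast.csInf_eq ⟨⟨x, hx, rfl⟩, ?_⟩
  rintro _ ⟨y, hy, rfl⟩
  exact h y hy

theorem Mstat_eq {m k : ℕ} (w : Equiv.Perm (Fin m)) (x : Fin m) (hx : (x : ℕ) ≤ k)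
    (h : ∀ y : Fin m, (y : ℕ) ≤ k → w y ≤ w x) : Mstat w k = w x := by
  refine IsGreatest.csSup_eq ⟨⟨x, hx, rfl⟩, ?_⟩
  rintro _ ⟨y, hy, rfl⟩
  exact h y hy

theorem isOccSet_p4321 {m : ℕ} {w : Equiv.Perm (Fin m)} {a b c d : Fin m}
    (hab : a < b) (hbc : b < c) (hcd : c < d)
    (h₁ : w d < w c) (h₂ : w c < w b) (h₃ : w b < w a) :
    ∃ S : Finset ℕ, IsOccSet p4321 w S := by
  refine ⟨_, ![a, b, c, d], ?_, ?_, rfl⟩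
  · rw [Fin.strictMono_iff_lt_succ]
    intro i
    fin_cases i <;> assumption
  · intro i j
    fin_cases i <;> fin_cases j <;> simp [p4321] <;> order

theorem isTopOccSet_p45312 {n : ℕ} {w : Equiv.Perm (Fin (n + 1))} {a b c d e : Fin (n + 1)}
    (hab : a < b) (hbc : b < c) (hcd : c < d) (hde : d < e) (hb : w b = Fin.last n)
    (h₁ : w d < w e) (h₂ : w e < w c) (h₃ : w c < w a) (h₄ : w a < w b) :
    ∃ S : Finset ℕ, IsTopOccSet p45312 w S := by
  refine ⟨_, ⟨![a, b, c, d, e], ?_, ?_, rfl⟩, ?_⟩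
  · rw [Fin.strictMono_iff_lt_succ]
    intro i
    fin_cases i <;> assumption
  · intro i j
    fin_cases i <;> fin_cases j <;> simp [p45312] <;> order
  · exact Finset.mem_image.2 ⟨1, Finset.mem_univ _, by simp [hb]⟩

theorem isTopOccSet_p53412 {n : ℕ} {w : Equiv.Perm (Fin (n + 1))} {a b c d e : Fin (n + 1)}
    (hab : a < b) (hbc : b < c) (hcd : c < d) (hde : d < e) (ha : w a = Fin.last n)
    (h₁ : w d < w e) (h₂ : w e < w b) (h₃ : w b < w c) (h₄ : w c < w a) :
    ∃ S : Finset ℕ, IsTopOccSet p53412 w S := by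
  refine ⟨_, ⟨![a, b, c, d, e], ?_, ?_, rfl⟩, ?_⟩
  · rw [Fin.strictMono_iff_lt_succ]
    intro i
    fin_cases i <;> assumption
  · intro i j
    fin_cases i <;> fin_cases j <;> simp [p53412] <;> order
  · exact Finset.mem_image.2 ⟨0, Finset.mem_univ _, by simp [ha]⟩

theorem posOf_eq {n : ℕ} {w : Equiv.Perm (Fin (n + 1))} {i : Fin (n + 1)}
    (h : w i = Fin.last n) : posOf w n = i := by
  have : w⁻¹ (Fin.last n) = i := by simp [← h]
  rw [posOf, dif_pos (Nat.lt_succ_self n)]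
  exact congrArg Fin.val this

theorem IsDeletion.apply_of_lt {n : ℕ} {w : Equiv.Perm (Fin (n + 1))}
    {wbar : Equiv.Perm (Fin n)} (h : IsDeletion w wbar) {y : Fin n}
    (hy : (y : ℕ) < posOf w n) : (wbar y : ℕ) = w y.castSucc := by
  rw [h y, if_pos hy, valAt, dif_pos (by omega)]
  rfl

theorem IsDeletion.apply_of_le {n : ℕ} {w : Equiv.Perm (Fin (n + 1))}
    {wbar : Equiv.Perm (Fin n)} (h : IsDeletion w wbar) {y : Fin n}
    (hy : posOf w n ≤ (y : ℕ)) : (wbar y : ℕ) = w y.succ := by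
  rw [h y, if_neg (by omega), valAt, dif_pos (by omega)]
  rfl

/-- if `w` is 4321-avoiding and some `N`-occurrence `{N > a > b}` of
321 in `w` has no `k ∈ newrep(w)` with `(a, b) ∈ {(M_k, m_k), (wbar(k), m_k)}`, then
`w` has an `N`-occurrence of 45312 or of 53412. -/
theorem must_use_Mstat_or_val {n : ℕ} (w : Equiv.Perm (Fin (n + 1)))
    (wbar : Equiv.Perm (Fin n)) (hdel : IsDeletion w wbar)
    (havoid : ¬ ∃ S : Finset ℕ, IsOccSet p4321 w S)
    (i1 i2 i3 : Fin (n + 1)) (h12 : i1 < i2) (h23 : i2 < i3)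
    (htop : w i1 = Fin.last n) (hd1 : w i2 < w i1) (hd2 : w i3 < w i2)
    (hab : ¬ ∃ k ∈ newrep w wbar,
      ((w i2 : ℕ) = Mstat wbar k ∨ (w i2 : ℕ) = valAt wbar k) ∧ (w i3 : ℕ) = mstat wbar k) :
    (∃ S : Finset ℕ, IsTopOccSet p45312 w S) ∨ (∃ S : Finset ℕ, IsTopOccSet p53412 w S) := by
  have hpos := posOf_eq htop
  have hlt_top : ∀ x : Fin (n + 1), x ≠ i1 → w x < w i1 := fun x hx =>
    lt_of_le_of_ne (htop ▸ Fin.le_last (w x)) (fun h => hx (w.injective h))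
  -- The positions in `wbar` of the letters `w i2` and `w i3`.
  obtain ⟨j2, rfl⟩ := Fin.exists_succ_eq.2 (Fin.ne_zero_of_lt h12)
  obtain ⟨j3, rfl⟩ := Fin.exists_succ_eq.2 (Fin.ne_zero_of_lt h23)
  have h12' : (i1 : ℕ) < j2 + 1 := h12
  have h23' : (j2 : ℕ) < j3 := Fin.succ_lt_succ_iff.1 h23
  have hw2 : (wbar j2 : ℕ) = w j2.succ := hdel.apply_of_le (by omega)
  have hw3 : (wbar j3 : ℕ) = w j3.succ := hdel.apply_of_le (by omega)
  have hinv : wbar j3 < wbar j2 := by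
    rw [Fin.lt_def, hw2, hw3]
    exact hd2
  have hnewrep : ∀ k : ℕ, (j2 : ℕ) ≤ k → k < j3 → k ∈ newrep w wbar := fun k hk₁ hk₂ =>
    ⟨mem_supp_of_inversion wbar j2 j3 hk₁ hk₂ hinv, by omega⟩
  have hafter : ∀ x, j3.succ < x → w j3.succ ≤ w x := fun x hx =>
    not_lt.1 fun h => havoid (isOccSet_p4321 h12 h23 hx h hd2 hd1)
  have hmstat : ∀ k : ℕ, (j2 : ℕ) ≤ k → k < j3 →
      (∀ x : Fin (n + 1), k + 1 < (x : ℕ) → x < j3.succ → w j3.succ ≤ w x) →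
      (w j3.succ : ℕ) = mstat wbar k := by
    intro k hk₁ hk₂ h
    rw [mstat_eq wbar j3 hk₂, hw3]
    intro y hy
    rw [Fin.le_def, hw3, hdel.apply_of_le (y := y) (by omega)]
    rcases lt_trichotomy y.succ j3.succ with h' | h' | h'
    · exact h _ (by simpa using hy) h'
    · rw [h']
    · exact hafter _ h'
  let C := Finset.univ.filter fun c => j2.succ < c ∧ c < j3.succ ∧ w c < w j3.succ
  have hC : C.Nonempty := by
    by_contra hC
    refine hab ⟨j2, hnewrep _ le_rfl h23', Or.inr ?_, hmstat _ le_rfl h23' ?_⟩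
    · rw [valAt, dif_pos j2.isLt, ← hw2]
    · intro x hx hx3
      refine not_lt.1 fun h => hC ⟨x, ?_⟩
      simp only [C, Finset.mem_filter, Finset.mem_univ, true_and]
      exact ⟨hx, hx3, h⟩
  -- Cut immediately after the last letter smaller than `w i3` lying between `w i2` and `w i3`.
  obtain ⟨c, hcC, hcmax⟩ := C.exists_max_image id hC
  simp only [C, Finset.mem_filter, Finset.mem_univ, true_and, id] at hcC hcmax
  obtain ⟨hc2, hc3, hcw⟩ := hcC
  obtain ⟨k, rfl⟩ := Fin.exists_succ_eq.2 (Fin.ne_zero_of_lt hc2)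
  have hk2 : (j2 : ℕ) < k := Fin.succ_lt_succ_iff.1 hc2
  have hk3 : (k : ℕ) < j3 := Fin.succ_lt_succ_iff.1 hc3
  have hm : (w j3.succ : ℕ) = mstat wbar k := by
    refine hmstat k hk2.le hk3 fun x hx hx3 => not_lt.1 fun h => ?_
    have hkx : k.succ < x := hx
    exact absurd (hcmax x ⟨hc2.trans hkx, hx3, h⟩) (not_le.2 hkx)
  obtain ⟨d, hdk, hdi, hdw⟩ : ∃ d, d ≤ k.succ ∧ d ≠ i1 ∧ w j2.succ < w d := by
    by_contra! hd
    refine hab ⟨k, hnewrep k hk2.le hk3, Or.inl ?_, hm⟩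
    rw [Mstat_eq wbar j2 hk2.le, hw2]
    intro y hy
    rw [Fin.le_def, hw2]
    rcases lt_or_ge (y : ℕ) (posOf w n) with h | h
    · rw [hdel.apply_of_lt h]
      refine hd _ ?_ ?_
      · rw [Fin.le_def, Fin.val_castSucc, Fin.val_succ]
        omega
      · rw [Ne, Fin.ext_iff, Fin.val_castSucc]
        omega
    · rw [hdel.apply_of_le h]
      refine hd _ (Fin.succ_le_succ_iff.2 hy) ?_
      rw [Ne, Fin.ext_iff, Fin.val_succ]
      omega
  have hdtop := hlt_top d hdi
  rcases lt_or_gt_of_ne hdi with h | h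
  · exact Or.inl (isTopOccSet_p45312 h h12 hc2 hc3 htop hcw hd2 hdw hdtop)
  · right
    have hd2' : j2.succ < d := by
      rcases lt_trichotomy d j2.succ with h' | h' | h'
      · exact absurd (isOccSet_p4321 h h' h23 hd2 hdw hdtop) havoid
      · exact absurd (h' ▸ hdw) (lt_irrefl _)
      · exact h'
    have hdc : d < k.succ := lt_of_le_of_ne hdk fun h' => by
      rw [h'] at hdw
      exact lt_asymm hdw (hcw.trans hd2)
    exact isTopOccSet_p53412 h12 hd2' hdc hc3 htop hcw hd2 hdw hdtop
end
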